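/- arXiv:1708.00928 — 4 statements merged into one kernel-verified Lean document; each statement's English description precedes it below -/
import Mathlib

section
/- Let n ≥ 3 and d ≥ 1 be integers and let (x,y) be a non-trivial primitive solution of 3x² + 2d² = yⁿ (so x ≠ 0 and gcd(x,y) = 1). Then there exists an ideal 𝔷 of ℤ[√-6] such that the principal ideal generated by 3x + d√-6 factors as (3x + d√-6)ℤ[√-6] = 𝔭₃ · 𝔷ⁿ, where 𝔭₃ = (3, √-6) is the unique prime ideal of ℤ[√-6] above 3. -/
/-- Ideal-theoretic core, valid in any commutative ring with an element of square `-6`. -/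
theorem stmt3_core {R : Type*} [CommRing R] (s X Y D A : R) (n : ℕ) (hs : s * s = -6)
    (hA : A = 3 * X + D * s) (h : 3 * X ^ 2 + 2 * D ^ 2 = Y ^ n)
    (h1 : IsCoprime (6 * X) Y) (h2 : IsCoprime (3 : R) (2 * D)) :
    Ideal.span {A} = Ideal.span {(3 : R), s} * (Ideal.span {A, Y}) ^ n := by
  set B : R := 3 * X - D * s with hB
  have hAB : A * B = 3 * Y ^ n := by
    rw [hA, hB, ← h]; linear_combination (-D ^ 2) * hs
  have hAB2 : A * (X * s + 2 * D) = s * Y ^ n := by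
    rw [hA, ← h]; linear_combination (D * X) * hs
  have hAz : A ∈ Ideal.span {A, Y} := Ideal.subset_span (by simp)
  have hYz : Y ∈ Ideal.span {A, Y} := Ideal.subset_span (by simp)
  have hYn : Y ^ n ∈ (Ideal.span {A, Y}) ^ n := Ideal.pow_mem_pow hYz n
  -- `z` and `(B)` are comaximal
  have hcop : IsCoprime (Ideal.span {A, Y}) (Ideal.span {B}) := by
    rw [Ideal.isCoprime_iff_exists]
    obtain ⟨u, v, huv⟩ := h1
    refine ⟨u * A + v * Y, Ideal.add_mem _ (Ideal.mul_mem_left _ _ hAz)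
      (Ideal.mul_mem_left _ _ hYz), u * B, Ideal.mem_span_singleton'.2 ⟨u, rfl⟩, ?_⟩
    rw [← huv, hA, hB]; ring
  have hAzn : A ∈ (Ideal.span {A, Y}) ^ n := by
    have key : ∀ k, k ≤ n → A ∈ (Ideal.span {A, Y}) ^ k := by
      intro k
      induction k with
      | zero => intro _; simp
      | succ k ih =>
        intro hk
        have hAk := ih (by omega)
        have hc := hcop.symm
        rw [Ideal.isCoprime_iff_exists] at hc
        obtain ⟨b, hb, c, hcz, hbc⟩ := hc
        obtain ⟨w, rfl⟩ := Ideal.mem_span_singleton'.1 hb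
        have e : A = (w * 3) * Y ^ n + A * c := by
          linear_combination w * hAB - A * hbc
        generalize Ideal.span {A, Y} = I at *
        rw [e]
        refine Ideal.add_mem _ (Ideal.mul_mem_left _ _ (Ideal.pow_le_pow_right hk hYn)) ?_
        rw [pow_succ]
        exact Ideal.mul_mem_mul hAk hcz
    exact key n le_rfl
  have hle : (Ideal.span {A, Y}) ^ n ≤ Ideal.span {A, Y ^ n} := by
    have key : ∀ k, (Ideal.span {A, Y}) ^ k ≤ Ideal.span {A, Y ^ k} := by
      intro k
      induction k with
      | zero => simp [Ideal.span_insert]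
      | succ k ih =>
        rw [pow_succ]
        refine (Ideal.mul_mono_left ih).trans ?_
        rw [Ideal.mul_le]
        intro r hr t ht
        obtain ⟨a, b, rfl⟩ := Ideal.mem_span_pair.1 hr
        obtain ⟨c, e, rfl⟩ := Ideal.mem_span_pair.1 ht
        exact Ideal.mem_span_pair.2 ⟨a * (c * A + e * Y) + b * Y ^ k * c, b * e, by ring⟩
    exact key n
  have h3 : (3 : R) ∈ Ideal.span {(3 : R), s} := Ideal.subset_span (by simp)
  have hs' : s ∈ Ideal.span {(3 : R), s} := Ideal.subset_span (by simp)
  apply le_antisymm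
  · rw [Ideal.span_singleton_le_iff_mem]
    obtain ⟨u, v, huv⟩ := h2
    have e : A = u * (3 * A) + (v * (s * Y ^ n) - (v * X) * (s * A)) := by
      linear_combination v * hAB2 - A * huv
    clear hle hcop hAz hYz
    generalize Ideal.span {A, Y} = I at *
    rw [e]
    exact Ideal.add_mem _ (Ideal.mul_mem_left _ _ (Ideal.mul_mem_mul h3 hAzn))
      (Ideal.sub_mem _ (Ideal.mul_mem_left _ _ (Ideal.mul_mem_mul hs' hYn))
        (Ideal.mul_mem_left _ _ (Ideal.mul_mem_mul hs' hAzn)))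
  · refine (Ideal.mul_mono_right hle).trans ?_
    rw [Ideal.mul_le]
    intro r hr t ht
    obtain ⟨a, b, rfl⟩ := Ideal.mem_span_pair.1 hr
    obtain ⟨c, e, rfl⟩ := Ideal.mem_span_pair.1 ht
    refine Ideal.mem_span_singleton'.2
      ⟨(a * 3 + b * s) * c + a * e * B + b * e * (X * s + 2 * D), ?_⟩
    linear_combination (a * e) * hAB + (b * e) * hAB2

/-- If `(x,y)` is a non-trivial primitive solution of `3x² + 2d² = yⁿ` with
`n ≥ 3` and `d ≥ 1`, then in `ℤ[√-6]` the principal ideal generated by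
`3x + d√-6` factors as `𝔭₃ · 𝔷ⁿ`, where `𝔭₃ = (3, √-6)` is the prime of
`ℤ[√-6]` above `3`. -/
theorem stmt3 (n : ℕ) (hn : 3 ≤ n) (d : ℤ) (hd : 1 ≤ d) (x y : ℤ)
    (hx : x ≠ 0) (hxy : IsCoprime x y) (h : 3 * x ^ 2 + 2 * d ^ 2 = y ^ n) :
    ∃ z : Ideal (Zsqrtd (-6)),
      Ideal.span {(3 * (x : Zsqrtd (-6)) + (d : Zsqrtd (-6)) * Zsqrtd.sqrtd)} =
        Ideal.span {(3 : Zsqrtd (-6)), Zsqrtd.sqrtd} * z ^ n := by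
  have p2 : Prime (2 : ℤ) := Int.prime_two
  have p3 : Prime (3 : ℤ) := Int.prime_three
  have hy2 : ¬ (2 : ℤ) ∣ y := by
    intro hy
    have h1 : (2 : ℤ) ∣ 3 * x ^ 2 := by
      have : (2 : ℤ) ∣ y ^ n := dvd_pow hy (by omega)
      rw [← h] at this
      exact (Int.dvd_add_left (Dvd.intro _ rfl)).1 this
    have h2 : (2 : ℤ) ∣ x :=
      p2.dvd_of_dvd_pow ((p2.dvd_or_dvd h1).resolve_left (by norm_num))
    exact p2.not_isUnit (hxy.isUnit_of_dvd' h2 hy)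
  have hd3 : ¬ (3 : ℤ) ∣ d := by
    intro hd
    have hy : (3 : ℤ) ∣ y := by
      apply p3.dvd_of_dvd_pow (n := n)
      rw [← h]
      exact dvd_add (Dvd.intro _ rfl) (Dvd.dvd.mul_left (dvd_pow hd (by norm_num)) _)
    have h9 : (3 : ℤ) * 3 ∣ 3 * x ^ 2 := by
      have h1 : (3 : ℤ) * 3 ∣ y ^ n := by
        rw [← pow_two]
        exact (pow_dvd_pow_of_dvd hy 2).trans (pow_dvd_pow y (by omega))
      rw [← h] at h1
      refine (Int.dvd_add_left ?_).1 h1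
      rw [← pow_two]
      exact Dvd.dvd.mul_left (pow_dvd_pow_of_dvd hd 2) _
    have h3 : (3 : ℤ) ∣ x := p3.dvd_of_dvd_pow (Int.dvd_of_mul_dvd_mul_left (by norm_num) h9)
    exact p3.not_isUnit (hxy.isUnit_of_dvd' h3 hy)
  have hy3 : ¬ (3 : ℤ) ∣ y := by
    intro hy
    have h1 : (3 : ℤ) ∣ 2 * d ^ 2 := by
      have : (3 : ℤ) ∣ y ^ n := dvd_pow hy (by omega)
      rw [← h] at this
      exact (Int.dvd_add_right (Dvd.intro _ rfl)).1 this
    exact hd3 (p3.dvd_of_dvd_pow ((p3.dvd_or_dvd h1).resolve_left (by norm_num)))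
  have c2 : IsCoprime (2 : ℤ) y := (p2.irreducible.coprime_iff_not_dvd).2 hy2
  have c3 : IsCoprime (3 : ℤ) y := (p3.irreducible.coprime_iff_not_dvd).2 hy3
  have cd : IsCoprime (3 : ℤ) (2 * d) := by
    refine (p3.irreducible.coprime_iff_not_dvd).2 fun hh => ?_
    exact hd3 ((p3.dvd_or_dvd hh).resolve_left (by norm_num))
  have c6 : IsCoprime (6 * x : ℤ) y := by
    have := (c2.mul_left c3).mul_left hxy
    norm_num at this
    exact this
  have g1 := c6.map (Int.castRingHom (Zsqrtd (-6)))
  have g2 := cd.map (Int.castRingHom (Zsqrtd (-6)))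
  have hR := congrArg (Int.cast : ℤ → Zsqrtd (-6)) h
  push_cast at hR
  simp only [map_mul, eq_intCast, Int.cast_ofNat] at g1 g2
  exact ⟨_, stmt3_core Zsqrtd.sqrtd (x : Zsqrtd (-6)) y d _ n
    (by ext <;> simp) rfl hR g1 g2⟩
end

section
/- Let n be an odd prime, d ≥ 1 an integer, and let (x,y) be a non-trivial primitive solution of 3x² + 2d² = yⁿ (so x ≠ 0 and gcd(x,y) = 1). Then there exist integers u, v such that in ℤ[√-6] one has 3^{(n-1)/2} · (3x + d√-6) = (3u + v√-6)ⁿ. -/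
theorem aux_cop3 (n : ℕ) (hn : 2 ≤ n) (d x y : ℤ) (hxy : IsCoprime x y)
    (h : 3 * x ^ 2 + 2 * d ^ 2 = y ^ n) : ¬ (3:ℤ) ∣ y := by
  intro h3
  have p3 : Prime (3:ℤ) := Int.prime_three
  have h9 : (9:ℤ) ∣ y ^ n := by
    have h1 : (3:ℤ)^2 ∣ y^2 := pow_dvd_pow_of_dvd h3 2
    have h2 := h1.trans (pow_dvd_pow y hn)
    norm_num at h2
    exact h2
  have hd : (3:ℤ) ∣ d := by
    have : (3:ℤ) ∣ d ^ 2 := by omega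
    exact p3.dvd_of_dvd_pow this
  have hx : (3:ℤ) ∣ x := by
    obtain ⟨e, rfl⟩ := hd
    have : (3:ℤ) ∣ x ^ 2 := by
      rw [← h] at h9
      ring_nf at h9
      omega
    exact p3.dvd_of_dvd_pow this
  exact p3.not_isUnit (hxy.isUnit_of_dvd' hx h3)

theorem aux_cop (n : ℕ) (hn : 2 ≤ n) (d x y : ℤ) (hxy : IsCoprime x y)
    (h : 3 * x ^ 2 + 2 * d ^ 2 = y ^ n) : IsCoprime 2 y ∧ IsCoprime d y := by
  have h3 : IsCoprime (3:ℤ) y :=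
    (Int.prime_three.coprime_iff_not_dvd).2 (aux_cop3 n hn d x y hxy h)
  have h1 : IsCoprime (3 * x^2) y := h3.mul_left hxy.pow_left
  obtain ⟨k, rfl⟩ : ∃ k, n = k + 1 := ⟨n - 1, by omega⟩
  have h2 : IsCoprime (2 * d ^ 2) y := by
    have : 2 * d^2 = -(3 * x^2) + y * y^k := by rw [← pow_succ']; linarith
    rw [this]
    exact (IsCoprime.neg_left h1).add_mul_left_left _
  refine ⟨h2.of_mul_left_left, ?_⟩
  have := h2.of_mul_left_right
  exact (IsCoprime.pow_left_iff (by norm_num)).1 this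

/-- Thue's lemma. -/
theorem aux_thue (y d x : ℤ) (hy : 0 < y) (hsq : ∀ m : ℤ, m ^ 2 ≠ y) :
    ∃ u v : ℤ, (u ≠ 0 ∨ v ≠ 0) ∧ u ^ 2 < y ∧ v ^ 2 < y ∧ y ∣ d * u - x * v := by
  lift y to ℕ using hy.le with Y
  have hY : 0 < Y := by exact_mod_cast hy
  haveI : NeZero Y := ⟨hY.ne'⟩
  set m := Nat.sqrt Y with hm
  have h1 : Y < (m+1) * (m+1) := Nat.lt_succ_sqrt Y
  have h2 : m * m ≤ Y := Nat.sqrt_le Y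
  have h3 : (m:ℤ)^2 < Y := by
    have : (m:ℤ)^2 ≤ Y := by rw [sq]; exact_mod_cast h2
    exact lt_of_le_of_ne this (hsq m)
  obtain ⟨a, b, hab, he⟩ := Fintype.exists_ne_map_eq_of_card_lt
    (fun p : Fin (m+1) × Fin (m+1) => (d : ZMod Y) * ((p.1 : ℕ) : ZMod Y) - x * ((p.2 : ℕ) : ZMod Y))
    (by simpa [ZMod.card] using h1)
  have bd : ∀ i j : Fin (m+1), ((i:ℤ) - (j:ℤ))^2 < Y := by
    intro i j
    have hi := i.2
    have hj := j.2
    refine lt_of_le_of_lt ?_ h3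
    apply sq_le_sq'  <;> omega
  refine ⟨(a.1:ℤ) - (b.1:ℤ), (a.2:ℤ) - (b.2:ℤ), ?_, bd _ _, bd _ _, ?_⟩
  · by_contra hc
    push Not at hc
    apply hab
    ext <;> omega
  · rw [← ZMod.intCast_zmod_eq_zero_iff_dvd _ Y]
    push_cast
    linear_combination he

theorem aux_rep (n : ℕ) (hn : 2 ≤ n) (hnodd : Odd n) (d x y : ℤ) (hx : x ≠ 0) (hxy : IsCoprime x y)
    (h : 3 * x ^ 2 + 2 * d ^ 2 = y ^ n) :
    ∃ u v : ℤ, 3 * u ^ 2 + 2 * v ^ 2 = y ∧ y ∣ d * u - x * v := by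
  obtain ⟨c2, cd⟩ := aux_cop n hn d x y hxy h
  have n3 := aux_cop3 n hn d x y hxy h
  have hy : 0 < y := by
    rw [← hnodd.pow_pos_iff, ← h]
    positivity
  -- `y` is 2 mod 3
  have hmod : ∀ s t : ℤ, y ≠ s ^ 2 + 3 * t := by
    intro s t hst
    have hY : (y : ZMod 3) = (s : ZMod 3)^2 := by
      rw [hst]; push_cast
      have : (3 : ZMod 3) = 0 := by decide
      rw [this]; ring
    have hh : ((3 * x ^ 2 + 2 * d ^ 2 : ℤ) : ZMod 3) = ((y ^ n : ℤ) : ZMod 3) := by rw [h]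
    push_cast at hh
    rw [hY, ← pow_mul, mul_comm 2 n, pow_mul] at hh
    have key : ∀ a b c : ZMod 3, 3 * a ^ 2 + 2 * b ^ 2 = c ^ 2 → c = 0 := by decide
    have hs := key _ _ _ hh
    have hs0 : (s : ZMod 3) = 0 := (haveI : Fact (Nat.Prime 3) := ⟨by norm_num⟩; (pow_eq_zero_iff (by omega)).1 hs)
    rw [hs0] at hY
    apply n3
    have := (ZMod.intCast_zmod_eq_zero_iff_dvd y 3).1 (by rw [hY]; decide)
    exact_mod_cast this
  obtain ⟨u, v, hne, hu, hv, hdvd⟩ := aux_thue y d x hy (fun m hm => hmod m 0 (by rw [hm]; ring))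
  have hk : y ∣ 3 * u ^ 2 + 2 * v ^ 2 := by
    have e : d ^ 2 * (3 * u ^ 2 + 2 * v ^ 2) =
      (d * u - x * v) * (3 * (d * u + x * v)) + y ^ n * v ^ 2 := by rw [← h]; ring
    have : y ∣ d ^ 2 * (3 * u ^ 2 + 2 * v ^ 2) := by
      rw [e]
      exact dvd_add (hdvd.mul_right _) ((dvd_pow_self y (by omega)).mul_right _)
    exact (cd.symm.pow_right).dvd_of_dvd_mul_left this
  obtain ⟨k, hk⟩ := hk
  have hk5 : k < 5 := by
    by_contra hc
    push Not at hc
    nlinarith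
  have hk0 : 0 < k := by
    have : 0 < 3 * u ^ 2 + 2 * v ^ 2 := by
      rcases hne with h | h <;> positivity
    rw [hk] at this
    exact (pos_iff_pos_of_mul_pos this).1 hy
  have p2 : Prime (2:ℤ) := Int.prime_two
  interval_cases k
  · exact ⟨u, v, by linarith, hdvd⟩
  · exfalso
    have : (2:ℤ) ∣ u := p2.dvd_of_dvd_pow (n := 2) (by omega)
    obtain ⟨w, rfl⟩ := this
    exact hmod v (2 * w ^ 2) (by nlinarith)
  · exfalso
    have : (3:ℤ) ∣ v := Int.prime_three.dvd_of_dvd_pow (n := 2) (by omega)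
    obtain ⟨w, rfl⟩ := this
    exact hmod u (2 * w ^ 2) (by nlinarith)
  · have : (2:ℤ) ∣ u := p2.dvd_of_dvd_pow (n := 2) (by omega)
    obtain ⟨a, rfl⟩ := this
    have : (2:ℤ) ∣ v := p2.dvd_of_dvd_pow (n := 2) (by ring_nf at hk; omega)
    obtain ⟨b, rfl⟩ := this
    refine ⟨a, b, by nlinarith, ?_⟩
    apply c2.symm.dvd_of_dvd_mul_left
    have e : 2 * (d * a - x * b) = d * (2 * a) - x * (2 * b) := by ring
    rw [e]
    exact hdvd

theorem aux_nzd (a b : Zsqrtd (-6)) (h : a * b = 0) (ha : a ≠ 0) : b = 0 := by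
  have h1 : a.norm * b.norm = 0 := by rw [← Zsqrtd.norm_mul, h]; rfl
  rcases mul_eq_zero.1 h1 with h2 | h2
  · exact absurd ((Zsqrtd.norm_eq_zero_iff (by norm_num) a).1 h2) ha
  · exact (Zsqrtd.norm_eq_zero_iff (by norm_num) b).1 h2

theorem aux_unit (e : Zsqrtd (-6)) (h : e.norm = 1) : e = 1 ∨ e = -1 := by
  obtain ⟨a, b⟩ := e
  simp only [Zsqrtd.norm_def] at h
  have hb : b = 0 := by
    by_contra hb
    have : 0 < b ^ 2 := by positivity
    nlinarith [sq_nonneg a]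
  subst hb
  have : (a - 1) * (a + 1) = 0 := by linarith
  rcases mul_eq_zero.1 this with h | h
  · left; ext <;> simp; omega
  · right; ext <;> simp; omega

theorem stmt4 (n : ℕ) (hn : n.Prime) (hnodd : Odd n) (d : ℤ) (hd : 1 ≤ d)
    (x y : ℤ) (hx : x ≠ 0) (hxy : IsCoprime x y)
    (h : 3 * x ^ 2 + 2 * d ^ 2 = y ^ n) :
    ∃ u v : ℤ,
      (3 : Zsqrtd (-6)) ^ ((n - 1) / 2) *
          (3 * (x : Zsqrtd (-6)) + (d : Zsqrtd (-6)) * Zsqrtd.sqrtd) =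
        (3 * (u : Zsqrtd (-6)) + (v : Zsqrtd (-6)) * Zsqrtd.sqrtd) ^ n := by
  have hn2 := hn.two_le
  obtain ⟨c2, cd⟩ := aux_cop n hn2 d x y hxy h
  have n3 := aux_cop3 n hn2 d x y hxy h
  obtain ⟨u, v, huv, hdvd⟩ := aux_rep n hn2 hnodd d x y hx hxy h
  have hy0 : y ≠ 0 := by
    rintro rfl
    rw [zero_pow (by omega)] at h
    nlinarith [sq_nonneg x]
  have hdvd2 : y ∣ 3 * x * u + 2 * d * v := by
    apply cd.symm.dvd_of_dvd_mul_left
    have e : d * (3 * x * u + 2 * d * v) = (d * u - x * v) * (3 * x) + y ^ n * v := by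
      rw [← h]; ring
    rw [e]
    exact dvd_add (hdvd.mul_right _) ((dvd_pow_self y (by omega)).mul_right _)
  obtain ⟨s2, hs2⟩ := hdvd
  obtain ⟨s1, hs1⟩ := hdvd2
  have hw : (Zsqrtd.sqrtd : Zsqrtd (-6)) * Zsqrtd.sqrtd = -6 := by
    ext <;> simp
  set w : Zsqrtd (-6) := Zsqrtd.sqrtd with hwdef
  set X : Zsqrtd (-6) := (x : Zsqrtd (-6)) with hX
  set D : Zsqrtd (-6) := (d : Zsqrtd (-6)) with hD
  set U : Zsqrtd (-6) := (u : Zsqrtd (-6)) with hU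
  set V : Zsqrtd (-6) := (v : Zsqrtd (-6)) with hV
  set Y : Zsqrtd (-6) := (y : Zsqrtd (-6)) with hY
  have hY0 : Y ≠ 0 := by rw [hY]; exact_mod_cast hy0
  have H : 3 * X ^ 2 + 2 * D ^ 2 = Y ^ n := by
    rw [hX, hD, hY]; exact_mod_cast congrArg (Int.cast : ℤ → Zsqrtd (-6)) h
  have HU : 3 * U ^ 2 + 2 * V ^ 2 = Y := by
    rw [hU, hV, hY]; exact_mod_cast congrArg (Int.cast : ℤ → Zsqrtd (-6)) huv
  have HS2 : D * U - X * V = Y * s2 := by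
    rw [hX, hD, hY, hU, hV]; exact_mod_cast congrArg (Int.cast : ℤ → Zsqrtd (-6)) hs2
  have HS1 : 3 * X * U + 2 * D * V = Y * s1 := by
    rw [hX, hD, hY, hU, hV]; exact_mod_cast congrArg (Int.cast : ℤ → Zsqrtd (-6)) hs1
  obtain ⟨β, hβ⟩ : ∃ β, β = 3 * X ^ 2 - 2 * D ^ 2 + 2 * X * D * w := ⟨_, rfl⟩
  obtain ⟨β', hβ'⟩ : ∃ β', β' = 3 * X ^ 2 - 2 * D ^ 2 - 2 * X * D * w := ⟨_, rfl⟩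
  obtain ⟨δ, hδ⟩ : ∃ δ, δ = 3 * U ^ 2 - 2 * V ^ 2 + 2 * U * V * w := ⟨_, rfl⟩
  obtain ⟨δ', hδ'⟩ : ∃ δ', δ' = 3 * U ^ 2 - 2 * V ^ 2 - 2 * U * V * w := ⟨_, rfl⟩
  have hbb : β * β' = Y ^ (2 * n) := by
    rw [mul_comm 2 n, pow_mul, ← H, hβ, hβ']
    linear_combination (-4 * X ^ 2 * D ^ 2) * hw
  have hdd : δ * δ' = Y ^ 2 := by
    rw [← HU, hδ, hδ']
    linear_combination (-4 * U ^ 2 * V ^ 2) * hw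
  have hcop : IsCoprime β β' := by
    have c : IsCoprime (2 * (3 * x ^ 2 - 2 * d ^ 2)) (y ^ (2 * n)) := by
      apply IsCoprime.pow_right
      apply c2.mul_left
      obtain ⟨k, rfl⟩ : ∃ k, n = k + 1 := ⟨n - 1, by omega⟩
      have : 3 * x ^ 2 - 2 * d ^ 2 = -(2 * 2 * d ^ 2) + y * y ^ k := by
        rw [← pow_succ', ← h]; ring
      rw [this]
      exact (IsCoprime.neg_left ((c2.mul_left c2).mul_left cd.pow_left)).add_mul_left_left _
    obtain ⟨a, b, hab⟩ := c
    have hab' := congrArg (Int.cast : ℤ → Zsqrtd (-6)) hab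
    push_cast at hab'
    rw [← hX, ← hD, ← hY, ← hbb] at hab'
    refine ⟨a + b * β', a, ?_⟩
    rw [← hab']
    rw [hβ, hβ']
    ring
  have hs : β = (s1 + s2 * w) ^ 2 * δ := by
    have e : Y ^ 2 * (β - (s1 + s2 * w) ^ 2 * δ) = 0 := by
      have e1 : β * δ' = (Y * s1 + Y * s2 * w) ^ 2 := by
        rw [← HS1, ← HS2, hβ, hδ']
        linear_combination (-4 * X * D * U * V - (D * U - X * V) ^ 2) * hw
      linear_combination (-β) * hdd + δ * e1
    exact sub_eq_zero.1 (aux_nzd _ _ e (by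
      intro h0
      rw [pow_two] at h0
      exact hY0 (aux_nzd _ _ h0 hY0)))
  have hdvd3 : δ ^ n ∣ β := by
    have c1 : IsCoprime δ β' := by
      rw [hs] at hcop
      exact hcop.of_mul_left_right
    refine (c1.pow_left (m := n)).dvd_of_dvd_mul_right ?_
    rw [hbb, pow_mul, ← hdd, mul_pow]
    exact dvd_mul_right _ _
  obtain ⟨ε, hε⟩ := hdvd3
  have nβ : β.norm = y ^ (2 * n) := by
    have : β = ⟨3 * x ^ 2 - 2 * d ^ 2, 2 * x * d⟩ := by
      rw [hβ, hX, hD, hwdef]; ext <;> simp [pow_two]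
    rw [this, Zsqrtd.norm_def, mul_comm 2 n, pow_mul, ← h]; ring
  have nδ : δ.norm = y ^ 2 := by
    have : δ = ⟨3 * u ^ 2 - 2 * v ^ 2, 2 * u * v⟩ := by
      rw [hδ, hU, hV, hwdef]; ext <;> simp [pow_two]
    rw [this, Zsqrtd.norm_def, ← huv]; ring
  have nε : ε.norm = 1 := by
    have := congrArg Zsqrtd.norm hε
    rw [Zsqrtd.norm_mul, nβ, show (δ ^ n).norm = δ.norm ^ n from map_pow Zsqrtd.normMonoidHom δ n,
      nδ, ← pow_mul] at this
    have hp : y ^ (2 * n) ≠ 0 := pow_ne_zero _ hy0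
    exact mul_left_cancel₀ hp (by rw [← this, mul_one])
  obtain ⟨m, hm⟩ := hnodd
  have hm' : (n - 1) / 2 = m := by omega
  have hα : (3 * X + D * w) ^ 2 = 3 * β := by
    rw [hβ]; linear_combination D ^ 2 * hw
  have hγ : (3 * U + V * w) ^ 2 = 3 * δ := by
    rw [hδ]; linear_combination V ^ 2 * hw
  rcases aux_unit ε nε with h1 | h1
  · have e : (3 ^ m * (3 * X + D * w)) ^ 2 = ((3 * U + V * w) ^ n) ^ 2 := by
      rw [← pow_mul, mul_comm n 2, pow_mul, hγ, mul_pow, hα, hε, h1, mul_pow, hm]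
      ring
    have e2 : (3 ^ m * (3 * X + D * w) - (3 * U + V * w) ^ n) *
        (3 ^ m * (3 * X + D * w) + (3 * U + V * w) ^ n) = 0 := by
      linear_combination e
    rw [hm']
    by_cases h0 : 3 ^ m * (3 * X + D * w) - (3 * U + V * w) ^ n = 0
    · exact ⟨u, v, sub_eq_zero.1 h0⟩
    · refine ⟨-u, -v, ?_⟩
      have e3 := aux_nzd _ _ e2 h0
      push_cast
      have : 3 * -(u : Zsqrtd (-6)) + -(v : Zsqrtd (-6)) * w = -(3 * U + V * w) := by
        rw [hU, hV]; ring
      rw [this, Odd.neg_pow ⟨m, hm⟩]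
      exact eq_neg_of_add_eq_zero_left e3
  · exfalso
    let φ : Zsqrtd (-6) →+* ZMod 3 := Zsqrtd.lift ⟨0, by decide⟩
    have hφw : φ w = 0 := by simp [φ, w]
    have t3 : (3 : ZMod 3) = 0 := by decide
    have e := congrArg φ hε
    rw [h1, hβ, hδ] at e
    simp only [map_mul, map_add, map_sub, map_pow, map_neg, map_one, hφw, hX, hD, hU, hV,
      map_intCast, map_ofNat, t3] at e
    have key : ∀ a b : ZMod 3, a ^ 2 = - b ^ 2 → a = 0 := by decide
    have e' : (d : ZMod 3) ^ 2 = - ((v : ZMod 3) ^ n) ^ 2 := by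
      have t2 : (-2 : ZMod 3) = 1 := by decide
      have q1 : ((0:ZMod 3) * (u:ZMod 3) ^ 2 - 2 * (v:ZMod 3) ^ 2 + 2 * (u:ZMod 3) * (v:ZMod 3) * 0) = (v:ZMod 3)^2 := by
        linear_combination (v:ZMod 3)^2 * t2
      rw [q1, ← pow_mul, mul_comm 2 n, pow_mul] at e
      linear_combination e - (d:ZMod 3)^2 * t2
    have hd0 := key _ _ e'
    have h3d : (3:ℤ) ∣ d := by
      exact_mod_cast (ZMod.intCast_zmod_eq_zero_iff_dvd d 3).1 hd0
    have h3v : (v : ZMod 3) = 0 := by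
      rw [hd0] at e'
      have key2 : ∀ b : ZMod 3, (0:ZMod 3) ^ 2 = - b ^ 2 → b = 0 := by decide
      haveI : Fact (Nat.Prime 3) := ⟨by norm_num⟩
      exact (pow_eq_zero_iff (by omega)).1 (key2 _ e')
    have h3v' : (3:ℤ) ∣ v := by
      exact_mod_cast (ZMod.intCast_zmod_eq_zero_iff_dvd v 3).1 h3v
    apply n3
    rw [← huv]
    exact dvd_add (dvd_mul_right _ _) ((dvd_pow h3v' (by norm_num)).mul_left _)
end

section
/- For every integer n ≥ 3, the equation 3x² + 2 = yⁿ has no integer solutions (x,y). In particular, the equation (x-1)² + x² + (x+1)² = yⁿ has no integer solutions for n ≥ 3. -/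
/-- A small-solution lemma of Thue type, by the pigeonhole principle. -/
lemma thue_aux (Y : ℕ) (hY : 0 < Y) (x : ℤ) :
    ∃ a b : ℤ, (a ≠ 0 ∨ b ≠ 0) ∧ a ^ 2 ≤ Y ∧ b ^ 2 ≤ Y ∧ (Y : ℤ) ∣ a - x * b := by
  have : NeZero Y := ⟨hY.ne'⟩
  set k := Nat.sqrt Y with hk
  have hcard : (Finset.univ : Finset (ZMod Y)).card <
      (Finset.range (k + 1) ×ˢ Finset.range (k + 1)).card := by
    rw [Finset.card_univ, ZMod.card, Finset.card_product, Finset.card_range]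
    exact Nat.lt_succ_sqrt Y
  obtain ⟨p, hp, q, hq, hne, heq⟩ := Finset.exists_ne_map_eq_of_card_lt_of_maps_to hcard
    (f := fun p : ℕ × ℕ => (((p.1 : ℤ) - x * (p.2 : ℤ) : ℤ) : ZMod Y))
    (fun _ _ => Finset.mem_coe.2 (Finset.mem_univ _))
  have hkk : (k : ℤ) * k ≤ Y := by exact_mod_cast Nat.sqrt_le Y
  simp only [Finset.mem_product, Finset.mem_range] at hp hq
  have bound : ∀ u v : ℕ, u < k + 1 → v < k + 1 → ((u : ℤ) - v) ^ 2 ≤ Y := by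
    intro u v hu hv
    have h1 : (u : ℤ) - v ≤ k := by omega
    have h2 : -(k : ℤ) ≤ (u : ℤ) - v := by omega
    nlinarith
  refine ⟨(p.1 : ℤ) - q.1, (p.2 : ℤ) - q.2, ?_, bound _ _ hp.1 hq.1, bound _ _ hp.2 hq.2, ?_⟩
  · by_contra! h
    apply hne
    ext
    · have := h.1; omega
    · have := h.2; omega
  · have h := (ZMod.intCast_eq_intCast_iff_dvd_sub _ _ Y).1 heq
    have h2 := (dvd_neg (a := (Y : ℤ))).2 h
    have e2 : (p.1 : ℤ) - q.1 - x * ((p.2 : ℤ) - q.2)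
        = -((q.1 : ℤ) - x * q.2 - ((p.1 : ℤ) - x * p.2)) := by ring
    rw [e2]
    exact h2

/-- The representation `y = 3a² + 2b²` compatible with the root `x`. -/
lemma rep_aux (x y : ℤ) (hy : 0 < y) (hodd : y % 2 = 1) (h3 : y % 3 = 2)
    (hd : y ∣ 3 * x ^ 2 + 2) :
    ∃ a b : ℤ, 3 * a ^ 2 + 2 * b ^ 2 = y ∧ y ∣ a - x * b := by
  obtain ⟨Y, rfl⟩ := Int.eq_ofNat_of_zero_le hy.le
  obtain ⟨a, b, hne, ha, hb, hab⟩ := thue_aux Y (by exact_mod_cast hy) x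
  have nsq : ∀ t : ℤ, t ^ 2 ≠ (Y : ℤ) := by
    intro t ht
    rw [← ht] at h3
    have : t % 3 = 0 ∨ t % 3 = 1 ∨ t % 3 = 2 := by omega
    rcases this with h | h | h <;> simp [pow_two, Int.mul_emod, h] at h3
  have ha' := lt_of_le_of_ne ha (nsq a)
  have hb' := lt_of_le_of_ne hb (nsq b)
  have hdv : (Y : ℤ) ∣ 3 * a ^ 2 + 2 * b ^ 2 := by
    obtain ⟨c, hc⟩ := hab
    obtain ⟨e, he⟩ := hd
    refine ⟨3 * c * (a + x * b) + b ^ 2 * e, ?_⟩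
    linear_combination 3 * (a + x * b) * hc + b ^ 2 * he
  obtain ⟨k, hk⟩ := hdv
  have hpos : 0 < 3 * a ^ 2 + 2 * b ^ 2 := by
    rcases hne with h | h <;> positivity
  have hk0 : 0 < k := by
    rw [hk] at hpos
    exact pos_of_mul_pos_right hpos hy.le
  have hk5 : k < 5 := by
    by_contra! h
    nlinarith
  generalize (Y : ℤ) = y at *
  have sq3 : ∀ t : ℤ, t ^ 2 % 3 = 0 ∨ t ^ 2 % 3 = 1 := by
    intro t
    have : t % 3 = 0 ∨ t % 3 = 1 ∨ t % 3 = 2 := by omega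
    rcases this with h | h | h <;> simp [pow_two, Int.mul_emod, h]
  have even_of : ∀ t : ℤ, t ^ 2 % 2 = 0 → ∃ s, t = 2 * s := by
    intro t ht
    have : t % 2 = 0 ∨ t % 2 = 1 := by omega
    rcases this with h | h
    · exact ⟨t / 2, by omega⟩
    · simp [pow_two, Int.mul_emod, h] at ht
  interval_cases k
  · exact ⟨a, b, by linarith, hab⟩
  · exfalso
    obtain ⟨s, rfl⟩ := even_of a (by omega)
    have h1 := sq3 b
    ring_nf at hk
    omega
  · exfalso
    have h1 := sq3 a
    have h2 := sq3 b
    have hb3 : (3 : ℤ) ∣ b := Int.prime_three.dvd_of_dvd_pow (n := 2) (by omega)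
    obtain ⟨s, rfl⟩ := hb3
    ring_nf at hk
    omega
  · obtain ⟨s, rfl⟩ := even_of a (by omega)
    obtain ⟨t, rfl⟩ := even_of b (by ring_nf at hk; ring_nf; omega)
    refine ⟨s, t, by linarith, ?_⟩
    have hcop : IsCoprime y 2 := ⟨1, -(y / 2), by omega⟩
    apply hcop.dvd_of_dvd_mul_left
    have e2 : 2 * (s - x * t) = 2 * s - x * (2 * t) := by ring
    rw [e2]
    exact hab

/-- Two-adic shape of an element: `1 + 2^r √-6` modulo `2^(r+1)`. -/
def TwoShape (r : ℕ) (z : ℤ√(-6)) : Prop :=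
  ∃ c d : ℤ, z.re = 1 + 2 ^ (r + 1) * c ∧ z.im = 2 ^ r * (2 * d + 1)

lemma twoShape_sq (r : ℕ) (hr : 1 ≤ r) (z : ℤ√(-6)) (h : TwoShape r z) :
    TwoShape (r + 1) (z * z) := by
  obtain ⟨c, d, h1, h2⟩ := h
  obtain ⟨s, rfl⟩ : ∃ s, r = s + 1 := ⟨r - 1, by omega⟩
  refine ⟨c + 2 ^ (s + 1) * c ^ 2 - 3 * 2 ^ s * (2 * d + 1) ^ 2,
    d + 2 ^ (s + 1) * c * (2 * d + 1), ?_, ?_⟩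
  · rw [Zsqrtd.re_mul, h1, h2]; ring
  · rw [Zsqrtd.im_mul, h1, h2]; ring

lemma twoShape_mul (r : ℕ) (hr : 2 ≤ r) (z w : ℤ√(-6)) (h : TwoShape r z) (hw : TwoShape 1 w) :
    TwoShape 1 (z * w) := by
  obtain ⟨c, d, h1, h2⟩ := h
  obtain ⟨c', d', h1', h2'⟩ := hw
  obtain ⟨s, rfl⟩ : ∃ s, r = s + 2 := ⟨r - 2, by omega⟩
  refine ⟨c' + 2 ^ (s + 1) * c * (1 + 4 * c') - 6 * 2 ^ (s + 1) * (2 * d + 1) * (2 * d' + 1),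
    d' + 2 ^ (s + 2) * c * (2 * d' + 1) + 2 ^ s * (2 * d + 1) * (1 + 4 * c'), ?_, ?_⟩
  · rw [Zsqrtd.re_mul, h1, h2, h1', h2']; ring
  · rw [Zsqrtd.im_mul, h1, h2, h1', h2']; ring

lemma twoShape_pow (β : ℤ√(-6)) (hβ : TwoShape 1 β) (m : ℕ) (hm : 0 < m) :
    ∃ r, 1 ≤ r ∧ (m % 2 = 0 → 2 ≤ r) ∧ TwoShape r (β ^ m) := by
  induction m using Nat.strong_induction_on with
  | _ m ih =>
    have heven : ∀ j, 0 < j → 2 * j ≤ m → ∃ r, 2 ≤ r ∧ TwoShape r (β ^ (2 * j)) := by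
      intro j hj hjm
      obtain ⟨r, hr, -, h⟩ := ih j (by omega) hj
      refine ⟨r + 1, by omega, ?_⟩
      rw [two_mul, pow_add]
      exact twoShape_sq r hr _ h
    rcases Nat.even_or_odd' m with ⟨j, rfl | rfl⟩
    · obtain ⟨r, hr, h⟩ := heven j (by omega) le_rfl
      exact ⟨r, by omega, fun _ => hr, h⟩
    · rcases Nat.eq_zero_or_pos j with rfl | hj
      · exact ⟨1, le_rfl, by omega, by simpa using hβ⟩
      · obtain ⟨r, hr, h⟩ := heven j hj (by omega)
        refine ⟨1, le_rfl, by omega, ?_⟩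
        rw [pow_succ]
        exact twoShape_mul r hr _ _ h hβ

/-- The real part of a power is a power modulo 3, and the imaginary part is divisible by `b`. -/
lemma pow_re_im (a b : ℤ) (m : ℕ) :
    (3 : ℤ) ∣ ((⟨3 * a ^ 2 - 2 * b ^ 2, 2 * a * b⟩ : ℤ√(-6)) ^ m).re - (b ^ 2) ^ m ∧
    b ∣ ((⟨3 * a ^ 2 - 2 * b ^ 2, 2 * a * b⟩ : ℤ√(-6)) ^ m).im := by
  induction m with
  | zero => simp
  | succ m ih =>
    obtain ⟨⟨c, hc⟩, ⟨d, hd⟩⟩ := ih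
    rw [pow_succ, Zsqrtd.re_mul, Zsqrtd.im_mul, hd]
    constructor
    · refine ⟨c * (3 * a ^ 2 - 2 * b ^ 2) + (b ^ 2) ^ m * (a ^ 2 - b ^ 2) - 4 * a * b ^ 2 * d, ?_⟩
      rw [pow_succ (b ^ 2) m]
      generalize ((⟨3 * a ^ 2 - 2 * b ^ 2, 2 * a * b⟩ : ℤ√(-6)) ^ m).re = w at *
      linear_combination (3 * a ^ 2 - 2 * b ^ 2) * hc
    · exact Dvd.intro
        (((⟨3 * a ^ 2 - 2 * b ^ 2, 2 * a * b⟩ : ℤ√(-6)) ^ m).re * (2 * a)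
          + d * (3 * a ^ 2 - 2 * b ^ 2)) (by ring)

/-- The final contradiction. -/
lemma final_aux (a b : ℤ) (m : ℕ) (hm : 0 < m) (ha : a % 2 = 1) (ε : ℤ)
    (h : ε * (b * ((⟨3 * a ^ 2 - 2 * b ^ 2, 2 * a * b⟩ : ℤ√(-6)) ^ m).re +
      3 * a * ((⟨3 * a ^ 2 - 2 * b ^ 2, 2 * a * b⟩ : ℤ√(-6)) ^ m).im) = 1) : False := by
  obtain ⟨h3, d, hd⟩ := pow_re_im a b m
  have hb : IsUnit b := by
    apply isUnit_of_dvd_one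
    rw [← h, hd]
    exact Dvd.intro (ε * (((⟨3 * a ^ 2 - 2 * b ^ 2, 2 * a * b⟩ : ℤ√(-6)) ^ m).re + 3 * a * d))
      (by ring)
  have hb2 : b ^ 2 = 1 := by
    rcases Int.isUnit_iff.1 hb with rfl | rfl <;> norm_num
  have hbo : b % 2 = 1 := by
    rcases Int.isUnit_iff.1 hb with rfl | rfl <;> norm_num
  obtain ⟨u, hu⟩ : ∃ u, a = 2 * u + 1 := ⟨a / 2, by omega⟩
  obtain ⟨v, hv⟩ : ∃ v, b = 2 * v + 1 := ⟨b / 2, by omega⟩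
  have hsh : TwoShape 1 (⟨3 * a ^ 2 - 2 * b ^ 2, 2 * a * b⟩ : ℤ√(-6)) := by
    refine ⟨3 * u ^ 2 + 3 * u, 2 * u * v + u + v, ?_, ?_⟩
    · simp only [hb2]; rw [hu]; ring
    · simp only; rw [hu, hv]; ring
  obtain ⟨r, -, -, c, e, hre, him⟩ := twoShape_pow _ hsh m hm
  generalize ((⟨3 * a ^ 2 - 2 * b ^ 2, 2 * a * b⟩ : ℤ√(-6)) ^ m) = z at *
  rw [hb2, one_pow] at h3
  have hval : z.re + 3 * (a * d) = 1 := by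
    rw [hd] at h
    have h' : (z.re + 3 * (a * d)) * (ε * b) = 1 := by linear_combination h
    rcases Int.isUnit_iff.1 (IsUnit.of_mul_eq_one _ h') with h1 | h1
    · exact h1
    · omega
  have h0 : (2 : ℤ) ^ r * (2 * c + 3 * a * b * (2 * e + 1)) = 0 := by
    have hbim : b * z.im = d := by rw [hd]; linear_combination d * hb2
    have : z.re + 3 * a * (b * z.im) = 1 := by rw [hbim]; linarith
    rw [hre, him] at this
    rw [pow_succ] at this
    linear_combination this
  have h1 : 2 * c + 3 * a * b * (2 * e + 1) = 0 := by
    rcases mul_eq_zero.1 h0 with h | h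
    · exact absurd h (by positivity)
    · exact h
  have h2 : 2 * (c + 3 * a * b * e + 3 * (2 * u * v + u + v) + 1) + 1 = 0 := by
    rw [← h1, hu, hv]; ring
  omega

lemma main_aux (m : ℕ) (hm : 0 < m) (x y : ℤ) (h : 3 * x ^ 2 + 2 = y ^ (2 * m + 1)) : False := by
  have hypos : 0 < y := by
    have : 0 < y ^ (2 * m + 1) := by rw [← h]; positivity
    exact (Odd.pow_pos_iff ⟨m, rfl⟩).1 this
  have hyodd : y % 2 = 1 := by
    by_contra hne
    obtain ⟨t, rfl⟩ : ∃ t, y = 2 * t := ⟨y / 2, by omega⟩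
    obtain ⟨k, rfl⟩ : ∃ k, m = k + 1 := ⟨m - 1, by omega⟩
    have h4 : 3 * x ^ 2 + 2 = 4 * (2 * t ^ 3 * (2 * t) ^ (2 * k)) := by rw [h]; ring
    have : x % 4 = 0 ∨ x % 4 = 1 ∨ x % 4 = 2 ∨ x % 4 = 3 := by omega
    have hx : x ^ 2 % 4 = 0 ∨ x ^ 2 % 4 = 1 := by
      rcases this with h | h | h | h <;> simp [pow_two, Int.mul_emod, h]
    omega
  have hy3 : y % 3 = 2 := by
    have hz : (y ^ m) ^ 2 * y = 3 * x ^ 2 + 2 := by rw [h]; ring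
    have hs : (y ^ m) ^ 2 % 3 = 0 ∨ (y ^ m) ^ 2 % 3 = 1 := by
      have : y ^ m % 3 = 0 ∨ y ^ m % 3 = 1 ∨ y ^ m % 3 = 2 := by omega
      rcases this with h | h | h <;> simp [pow_two, Int.mul_emod, h]
    have h1 : ((y ^ m) ^ 2 * y) % 3 = 2 := by omega
    rw [Int.mul_emod] at h1
    rcases hs with h | h <;> rw [h] at h1 <;> omega
  obtain ⟨a, b, hab, q, hq⟩ := rep_aux x y hypos hyodd hy3 (h ▸ dvd_pow_self y (by omega))
  -- the quotient `δ = e + f √-6`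
  obtain ⟨e, he⟩ : y ∣ 3 * x * a + 2 * b := by
    have hd : y ∣ 3 * x ^ 2 + 2 := h ▸ dvd_pow_self y (by omega)
    obtain ⟨w, hw⟩ := hd
    exact ⟨3 * x * q + b * w, by linear_combination 3 * x * hq + b * hw⟩
  have hx : a * e - 2 * b * q = x := by
    apply mul_left_cancel₀ hypos.ne'
    linear_combination (-a) * he + 2 * b * hq + x * hab
  have h1 : b * e + 3 * a * q = 1 := by
    apply mul_left_cancel₀ hypos.ne'
    linear_combination (-b) * he - 3 * a * hq + hab
  have ha : a % 2 = 1 := by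
    by_contra hne
    obtain ⟨t, rfl⟩ : ∃ t, a = 2 * t := ⟨a / 2, by omega⟩
    ring_nf at hab
    omega
  set β : ℤ√(-6) := ⟨3 * a ^ 2 - 2 * b ^ 2, 2 * a * b⟩ with hβ
  set δ : ℤ√(-6) := ⟨e, q⟩ with hδ
  set G : ℤ√(-6) := ⟨3 * x ^ 2 - 2, 2 * x⟩ with hG
  have hGβ : G = β * δ ^ 2 := by
    rw [pow_two]
    ext
    · simp only [hG, hβ, hδ, Zsqrtd.re_mul, Zsqrtd.im_mul]
      rw [← hx]
      linear_combination 2 * (b * e + 3 * a * q + 1) * h1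
    · simp only [hG, hβ, hδ, Zsqrtd.re_mul, Zsqrtd.im_mul]
      rw [← hx]
      linear_combination (-2) * (a * e - 2 * b * q) * h1
  have hββ : β * star β = ((y ^ 2 : ℤ) : ℤ√(-6)) := by
    ext
    · simp only [hβ, Zsqrtd.re_mul, Zsqrtd.re_star, Zsqrtd.im_star, Zsqrtd.re_intCast]
      rw [← hab]; ring
    · simp only [hβ, Zsqrtd.im_mul, Zsqrtd.re_star, Zsqrtd.im_star, Zsqrtd.im_intCast]
      ring
  have hδn : e ^ 2 + 6 * q ^ 2 = (y ^ 2) ^ m := by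
    apply mul_left_cancel₀ hypos.ne'
    have : y * (y ^ 2) ^ m = 3 * x ^ 2 + 2 := by rw [h]; ring
    rw [this, ← hab, ← hx]
    linear_combination 2 * (b * e + 3 * a * q + 1) * h1
  have hδδ : δ * star δ = ((y ^ 2 : ℤ) : ℤ√(-6)) ^ m := by
    rw [← Int.cast_pow, ← hδn]
    ext
    · simp only [hδ, Zsqrtd.re_mul, Zsqrtd.re_star, Zsqrtd.im_star, Zsqrtd.re_intCast]
      ring
    · simp only [hδ, Zsqrtd.im_mul, Zsqrtd.re_star, Zsqrtd.im_star, Zsqrtd.im_intCast]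
      ring
  have hcopG : IsCoprime G (star G) := by
    have hxo : x % 2 = 1 := by
      have : (3 * x ^ 2 + 2) % 2 = 1 := by
        rw [h]
        exact Int.odd_iff.1 ((Int.odd_iff.2 hyodd).pow)
      by_contra hne
      obtain ⟨t, rfl⟩ : ∃ t, x = 2 * t := ⟨x / 2, by omega⟩
      ring_nf at this
      omega
    have h16 : IsCoprime (16 : ℤ) ((3 * x ^ 2 + 2) ^ 2) := by
      have h2 : IsCoprime (2 : ℤ) (3 * x ^ 2 + 2) := by
        obtain ⟨t, rfl⟩ : ∃ t, x = 2 * t + 1 := ⟨x / 2, by omega⟩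
        exact ⟨-(6 * t ^ 2 + 6 * t + 2), 1, by ring⟩
      have := h2.pow (m := 4) (n := 2)
      norm_num at this
      exact this
    obtain ⟨s, t, hst⟩ := h16
    -- 16 = 24 x² - 4 (G + star G),  24 x² = -√-6 x (G - star G)
    refine ⟨(s : ℤ√(-6)) * (⟨-4, -x⟩) + (t : ℤ√(-6)) * star G, (s : ℤ√(-6)) * ⟨-4, x⟩, ?_⟩
    have hst' : s * 16 + t * (3 * x ^ 2 + 2) ^ 2 = 1 := hst
    ext
    · simp [hG, Zsqrtd.re_mul, Zsqrtd.im_mul]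
      linear_combination hst'
    · simp [hG, Zsqrtd.re_mul, Zsqrtd.im_mul]
      ring
  have hcop : IsCoprime β (star δ) := by
    refine (hcopG.of_isCoprime_of_dvd_left ⟨_, hGβ⟩).of_isCoprime_of_dvd_right ?_
    rw [hGβ, star_mul, star_pow, pow_two]
    exact ⟨star δ * star β, by ring⟩
  have hdvd : β ^ m ∣ δ := by
    apply (hcop.pow_left (m := m)).dvd_of_dvd_mul_right
    rw [hδδ, ← hββ, mul_pow]
    exact dvd_mul_right _ _
  obtain ⟨η, hη⟩ := hdvd
  have hnη : η.norm = 1 := by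
    have hy0 : ((y ^ 2) ^ 2) ^ m ≠ 0 := by positivity
    have hnβ : β.norm = y ^ 2 := by
      simp only [hβ, Zsqrtd.norm]; rw [← hab]; ring
    have hnδ : δ.norm = (y ^ 2) ^ m := by
      simp only [hδ, Zsqrtd.norm]; rw [← hδn]; ring
    have hnp : (β ^ m).norm = (y ^ 2) ^ m := by
      rw [← hnβ]; exact map_pow Zsqrtd.normMonoidHom β m
    have := congrArg Zsqrtd.norm hη
    rw [Zsqrtd.norm_mul, hnδ, hnp] at this
    have hy1 : (y ^ 2) ^ m ≠ 0 := by positivity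
    apply mul_left_cancel₀ hy1
    linarith
  have him : η.im = 0 := by
    simp only [Zsqrtd.norm] at hnη
    by_contra hne
    have : 0 < η.im ^ 2 := by positivity
    nlinarith [sq_nonneg η.re]
  have hre := congrArg Zsqrtd.re hη
  have hiq := congrArg Zsqrtd.im hη
  rw [Zsqrtd.re_mul, him] at hre
  rw [Zsqrtd.im_mul, him] at hiq
  simp only [hδ] at hre hiq
  refine final_aux a b m hm ha η.re ?_
  rw [← hβ, ← h1, hre, hiq]
  ring

/-- For every `n ≥ 3`, the equation `3x² + 2 = yⁿ` has no integer solutions;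
in particular `(x-1)² + x² + (x+1)² = yⁿ` has no integer solutions. -/
theorem stmt9 (n : ℕ) (hn : 3 ≤ n) :
    (¬ ∃ x y : ℤ, 3 * x ^ 2 + 2 = y ^ n) ∧
      ¬ ∃ x y : ℤ, (x - 1) ^ 2 + x ^ 2 + (x + 1) ^ 2 = y ^ n := by
  have key : ¬ ∃ x y : ℤ, 3 * x ^ 2 + 2 = y ^ n := by
    rintro ⟨x, y, h⟩
    rcases Nat.even_or_odd' n with ⟨m, rfl | rfl⟩
    · have hz : (y ^ m) ^ 2 = 3 * x ^ 2 + 2 := by rw [h]; ring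
      have hs : (y ^ m) ^ 2 % 3 = 0 ∨ (y ^ m) ^ 2 % 3 = 1 := by
        have : y ^ m % 3 = 0 ∨ y ^ m % 3 = 1 ∨ y ^ m % 3 = 2 := by omega
        rcases this with h | h | h <;> simp [pow_two, Int.mul_emod, h]
      omega
    · exact main_aux m (by omega) x y h
  refine ⟨key, ?_⟩
  rintro ⟨x, y, h⟩
  exact key ⟨x, y, by rw [← h]; ring⟩
end

section
/- Let n be an odd prime, let p be a prime with p ∤ 6, let b′ ≥ 1 be an integer, and let u, v be nonzero integers such that gcd(12u², 3u² + 2v²) = 1, (3u + v√-6)ᵏ ≠ (3u - v√-6)ᵏ for all integers k ≥ 1, and f_n(u,v) = p^{b′}. Set B = p - 1 if -6 is a quadratic residue modulo p, and B = p + 1 otherwise. Then n ≤ max(7, B). -/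
open scoped Classical

/-- The polynomial `f_n(X,Y) = Σ_{i=0}^{(n-1)/2} C(n,2i+1)·(-2)^i·3^((n-1)/2-i)·X^(n-1-2i)·Y^(2i)`
evaluated at integers; for odd `n` it is the `n`-th term of the Lehmer sequence
attached to the Lehmer pair `((3u+v√-6)/√3, (3u-v√-6)/√3)`. -/
def fpoly (n : ℕ) (x y : ℤ) : ℤ :=
  ∑ i ∈ Finset.range ((n - 1) / 2 + 1),
    (n.choose (2 * i + 1) : ℤ) * (-2) ^ i * 3 ^ ((n - 1) / 2 - i) *
      x ^ (n - 1 - 2 * i) * y ^ (2 * i)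

lemma aux_sum_even_odd {R : Type*} [CommRing R] (g : ℕ → R) (N : ℕ) :
    ∑ k ∈ Finset.range (2 * N), g k = ∑ i ∈ Finset.range N, (g (2 * i) + g (2 * i + 1)) := by
  induction N with
  | zero => simp
  | succ N ih =>
    rw [show 2 * (N + 1) = 2 * N + 1 + 1 by ring, Finset.sum_range_succ, Finset.sum_range_succ,
      Finset.sum_range_succ, ih]
    ring

lemma aux_identity {R : Type*} [CommRing R] (s : R) (hs : s ^ 2 = -6) (u v : ℤ) (m : ℕ) :
    (3 * (u : R) + v * s) ^ (2 * m + 1) - (3 * (u : R) - v * s) ^ (2 * m + 1)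
      = 2 * v * s * 3 ^ m * (fpoly (2 * m + 1) u v : R) := by
  have key : ∀ x y : R, (x + y) ^ (2 * m + 1) - (x - y) ^ (2 * m + 1) =
      ∑ i ∈ Finset.range (m + 1), 2 * (y ^ (2 * i + 1) * x ^ (2 * m - 2 * i) *
        ((2 * m + 1).choose (2 * i + 1) : R)) := by
    intro x y
    rw [add_comm x y, show x - y = -y + x by ring, add_pow, add_pow, ← Finset.sum_sub_distrib,
      show 2 * m + 1 + 1 = 2 * (m + 1) by ring, aux_sum_even_odd]
    apply Finset.sum_congr rfl
    intro i hi
    rw [show 2 * m + 1 - (2 * i + 1) = 2 * m - 2 * i by omega, neg_pow y (2 * i),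
      neg_pow y (2 * i + 1), pow_succ (-1 : R) (2 * i), pow_mul (-1 : R) 2 i]
    simp
    ring
  rw [key, fpoly, Int.cast_sum, Finset.mul_sum]
  apply Finset.sum_congr (by rw [show (2 * m + 1 - 1) / 2 = m by omega])
  intro i hi
  have hi' : i ≤ m := by
    have := Finset.mem_range.mp hi
    omega
  obtain ⟨j, rfl⟩ := Nat.exists_eq_add_of_le hi'
  rw [show (2 * (i + j) + 1 - 1) / 2 - i = j by omega,
    show 2 * (i + j) + 1 - 1 - 2 * i = 2 * j by omega,
    show 2 * (i + j) - 2 * i = 2 * j by omega]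
  push_cast
  have h1 : (v * s) ^ (2 * i + 1) = v ^ (2 * i) * v * s * ((-2) ^ i * 3 ^ i) := by
    rw [← mul_pow, show (-2 : R) * 3 = s ^ 2 by rw [hs]; ring]
    ring
  rw [h1, mul_pow, pow_mul (3 : R) 2 j]
  rw [show ((3 : R) ^ 2) ^ j = 3 ^ j * 3 ^ j by rw [← mul_pow]; norm_num]
  ring

lemma aux_mod_v (m : ℕ) (u v : ℤ) :
    v ^ 2 ∣ fpoly (2 * m + 1) u v - (2 * m + 1 : ℕ) * 3 ^ m * u ^ (2 * m) := by
  rw [fpoly, Finset.sum_range_succ']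
  have h : (((2 * m + 1).choose (2 * 0 + 1) : ℕ) : ℤ) * (-2) ^ 0 * 3 ^ ((2 * m + 1 - 1) / 2 - 0) *
      u ^ (2 * m + 1 - 1 - 2 * 0) * v ^ (2 * 0) = (2 * m + 1 : ℕ) * 3 ^ m * u ^ (2 * m) := by
    simp
  rw [h, add_sub_cancel_right]
  apply Finset.dvd_sum
  intro i _
  exact Dvd.dvd.mul_left (pow_dvd_pow v (by omega)) _

lemma aux_val (N e j : ℕ) (hj : 1 ≤ j) (hN : 2 * j ≤ N) (he : 3 ^ e ∣ N - 1) :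
    3 ^ (e + 1) ∣ N.choose (2 * j) * 3 ^ j := by
  obtain ⟨k, rfl⟩ : ∃ k, j = k + 1 := ⟨j - 1, by omega⟩
  obtain ⟨M, rfl⟩ : ∃ M, N = M + 2 := ⟨N - 2, by omega⟩
  have h1 := Nat.add_one_mul_choose_eq (M + 1) (2 * k + 1)
  have h2 := Nat.add_one_mul_choose_eq M (2 * k)
  have h3 : (M + 2).choose (2 * (k + 1)) * ((2 * k + 1) * (2 * k + 2)) =
      (M + 1) * ((M + 2) * M.choose (2 * k)) := by
    rw [show 2 * (k + 1) = 2 * k + 1 + 1 by ring]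
    calc _ = ((M + 1 + 1).choose (2 * k + 1 + 1) * (2 * k + 1 + 1)) * (2 * k + 1) := by ring
      _ = (M + 2) * ((M + 1).choose (2 * k + 1) * (2 * k + 1)) := by rw [← h1]; ring
      _ = _ := by rw [← h2]; ring
  have he' : 3 ^ e ∣ M + 1 := by simpa using he
  obtain ⟨a, c, hc, hac⟩ := Nat.exists_eq_pow_mul_and_not_dvd
    (n := (2 * k + 1) * (2 * k + 2)) (by positivity) 3 (by norm_num)
  have ha : a < k + 1 := by
    have hd : 3 ^ a ∣ (2 * k + 1) * (2 * k + 2) := ⟨c, hac⟩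
    have hle : 3 ^ a ≤ 2 * k + 2 := by
      by_cases h : 3 ∣ 2 * k + 1
      · have hcp : Nat.Coprime (3 ^ a) (2 * k + 2) := by
          apply Nat.Coprime.pow_left
          rw [Nat.Prime.coprime_iff_not_dvd Nat.prime_three]
          omega
        have := Nat.le_of_dvd (by omega) (hcp.dvd_of_dvd_mul_right hd)
        omega
      · have hcp : Nat.Coprime (3 ^ a) (2 * k + 1) := by
          apply Nat.Coprime.pow_left
          rw [Nat.Prime.coprime_iff_not_dvd Nat.prime_three]
          exact h
        exact Nat.le_of_dvd (by omega) (hcp.dvd_of_dvd_mul_left hd)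
    have hlt : 2 * k + 2 < 3 ^ (k + 1) := by
      clear * -
      induction k with
      | zero => norm_num
      | succ k ih => rw [pow_succ]; omega
    exact (Nat.pow_lt_pow_iff_right (by norm_num)).mp (lt_of_le_of_lt hle hlt)
  have h4 : 3 ^ e * 3 ^ (k + 1) ∣ ((M + 2).choose (2 * (k + 1)) * 3 ^ (k + 1)) * (3 ^ a * c) := by
    rw [← hac, mul_right_comm, h3]
    exact mul_dvd_mul (Dvd.dvd.mul_right he' _) dvd_rfl
  obtain ⟨d, hd⟩ := Nat.exists_eq_add_of_lt ha
  rw [hd, show 3 ^ e * 3 ^ (a + d + 1) = 3 ^ a * 3 ^ (e + 1 + d) by ring, ← hd,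
    show ((M + 2).choose (2 * (k + 1)) * 3 ^ (k + 1)) * (3 ^ a * c) =
      3 ^ a * (((M + 2).choose (2 * (k + 1)) * 3 ^ (k + 1)) * c) by ring] at h4
  have h5 := Nat.dvd_of_mul_dvd_mul_left (by positivity) h4
  have hcp : Nat.Coprime (3 ^ (e + 1 + d)) c := by
    apply Nat.Coprime.pow_left
    rw [Nat.Prime.coprime_iff_not_dvd Nat.prime_three]
    exact hc
  exact (pow_dvd_pow 3 (by omega)).trans (hcp.dvd_of_dvd_mul_right h5)

lemma aux_three (m e : ℕ) (u v : ℤ) (hv : ¬ (3 : ℤ) ∣ v) (he : 3 ^ e ∣ 2 * m) :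
    (3 : ℤ) ^ (e + 1) ∣ fpoly (2 * m + 1) u v - 1 := by
  rw [fpoly, Finset.sum_range_succ, add_sub_assoc]
  apply dvd_add
  · apply Finset.dvd_sum
    intro i hi
    have hi' : i < m := by
      have := Finset.mem_range.mp hi
      omega
    have h := aux_val (2 * m + 1) e (m - i) (by omega) (by omega) (by simpa using he)
    rw [show (2 * m + 1).choose (2 * (m - i)) = (2 * m + 1).choose (2 * i + 1) by
      rw [← Nat.choose_symm (show 2 * i + 1 ≤ 2 * m + 1 by omega)]
      congr 1
      omega] at h
    have h' : (3 : ℤ) ^ (e + 1) ∣ ((2 * m + 1).choose (2 * i + 1) : ℤ) * 3 ^ (m - i) := by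
      exact_mod_cast h
    rw [show (2 * m + 1 - 1) / 2 - i = m - i by omega]
    apply Dvd.dvd.mul_right
    apply Dvd.dvd.mul_right
    rw [mul_right_comm]
    exact Dvd.dvd.mul_right h' _
  · have hem : 3 ^ e ∣ m := by
      apply Nat.Coprime.dvd_of_dvd_mul_left _ he
      apply Nat.Coprime.pow_left
      norm_num
    obtain ⟨t, rfl⟩ := hem
    have h3 : (3 : ℤ) ∣ -2 * v ^ 2 - 1 := by
      have : v % 3 = 1 ∨ v % 3 = 2 := by omega
      have h9 : (3 : ℤ) ∣ v ^ 2 - 1 := by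
        rw [show v ^ 2 - 1 = (v - 1) * (v + 1) by ring]
        rcases this with h | h
        · exact Dvd.dvd.mul_right (by omega) _
        · exact Dvd.dvd.mul_left (by omega) _
      omega
    have h4 : (3 : ℤ) ^ (e + 1) ∣ (-2 * v ^ 2) ^ 3 ^ e - 1 ^ 3 ^ e := by
      have := dvd_sub_pow_of_dvd_sub (R := ℤ) (p := 3) (by exact_mod_cast h3) e
      exact_mod_cast this
    have h5 := h4.trans (sub_dvd_pow_sub_pow ((-2 * v ^ 2) ^ 3 ^ e) (1 ^ 3 ^ e) t)
    convert h5 using 1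
    rw [show (2 * (3 ^ e * t) + 1 - 1) / 2 = 3 ^ e * t by omega]
    rw [Nat.choose_self, show 2 * (3 ^ e * t) + 1 - 1 - 2 * (3 ^ e * t) = 0 by omega,
      Nat.sub_self, one_pow, one_pow, ← pow_mul, mul_pow, ← pow_mul]
    simp

lemma aux_not_p (m : ℕ) (hm : 1 ≤ m) (u v : ℤ) (hv : ¬ (3 : ℤ) ∣ v) :
    fpoly (2 * m + 1) u v ≠ (2 * m + 1 : ℕ) := by
  intro h
  have key : ∀ e : ℕ, 3 ^ e ∣ 2 * m := by
    intro e
    induction e with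
    | zero => simp
    | succ e ih =>
      have := aux_three m e u v hv ih
      rw [h] at this
      push_cast at this
      rw [add_sub_cancel_right] at this
      exact_mod_cast this
  have h1 := Nat.le_of_dvd (by omega) (key (2 * m))
  have h2 := Nat.lt_pow_self (n := 2 * m) (a := 3) (by norm_num)
  omega

lemma aux_p_dvd (m : ℕ) (hp : (2 * m + 1).Prime) (h6 : ¬ (2 * m + 1) ∣ 6) (u v : ℤ)
    (h : ((2 * m + 1 : ℕ) : ℤ) ∣ fpoly (2 * m + 1) u v) : ((2 * m + 1 : ℕ) : ℤ) ∣ v := by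
  have hpi := Nat.prime_iff_prime_int.mp hp
  rw [fpoly, Finset.sum_range_succ, dvd_add_right] at h
  · rw [show (2 * m + 1 - 1) / 2 = m by omega, Nat.choose_self] at h
    simp only [Nat.cast_one, one_mul, Nat.sub_self, pow_zero, mul_one,
      show 2 * m + 1 - 1 - 2 * m = 0 by omega] at h
    rcases hpi.dvd_or_dvd h with h | h
    · exfalso
      have h2 := hpi.dvd_of_dvd_pow h
      rw [dvd_neg] at h2
      have h2' : 2 * m + 1 ∣ 2 := by exact_mod_cast h2
      exact h6 (h2'.trans (by norm_num))
    · exact hpi.dvd_of_dvd_pow h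
  · apply Finset.dvd_sum
    intro i hi
    have hi' : i < m := by
      have := Finset.mem_range.mp hi
      omega
    have : 2 * m + 1 ∣ (2 * m + 1).choose (2 * i + 1) :=
      hp.dvd_choose_self (by omega) (by omega)
    have : ((2 * m + 1 : ℕ) : ℤ) ∣ ((2 * m + 1).choose (2 * i + 1) : ℤ) := by exact_mod_cast this
    simp only [mul_assoc]
    exact Dvd.dvd.mul_right this _

lemma aux_case_eq (m b' : ℕ) (hp : (2 * m + 1).Prime) (h6 : ¬ (2 * m + 1) ∣ 6) (hb : 1 ≤ b')
    (u v : ℤ) (hcop : IsCoprime (12 * u ^ 2) (3 * u ^ 2 + 2 * v ^ 2))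
    (hf : fpoly (2 * m + 1) u v = ((2 * m + 1 : ℕ) : ℤ) ^ b') : False := by
  have hpi := Nat.prime_iff_prime_int.mp hp
  have hm : 1 ≤ m := by
    by_contra hm
    have : m = 0 := by omega
    subst this
    exact h6 (by norm_num)
  have hv3 : ¬ (3 : ℤ) ∣ v := by
    intro h
    have h3 : IsUnit (3 : ℤ) := hcop.isUnit_of_dvd'
      (Dvd.dvd.mul_right (by norm_num) _)
      (dvd_add (dvd_mul_right _ _) (Dvd.dvd.mul_left (dvd_pow h (by norm_num)) _))
    rw [Int.isUnit_iff] at h3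
    omega
  have hpv : ((2 * m + 1 : ℕ) : ℤ) ∣ v :=
    aux_p_dvd m hp h6 u v (by rw [hf]; exact dvd_pow_self _ (by omega))
  have hpu : ¬ ((2 * m + 1 : ℕ) : ℤ) ∣ u := by
    intro h
    exact hpi.not_isUnit (hcop.isUnit_of_dvd'
      (Dvd.dvd.mul_left (dvd_pow h (by norm_num)) _)
      (dvd_add (Dvd.dvd.mul_left (dvd_pow h (by norm_num)) _)
        (Dvd.dvd.mul_left (dvd_pow hpv (by norm_num)) _)))
  by_cases hb1 : b' = 1
  · subst hb1
    rw [pow_one] at hf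
    exact aux_not_p m hm u v hv3 hf
  · have h1 := (pow_dvd_pow_of_dvd hpv 2).trans (aux_mod_v m u v)
    rw [hf, dvd_sub_right (pow_dvd_pow _ (by omega)), pow_two, mul_assoc,
      mul_dvd_mul_iff_left hpi.ne_zero] at h1
    rcases hpi.dvd_or_dvd h1 with h | h
    · have h3 := hpi.dvd_of_dvd_pow h
      have h3' : 2 * m + 1 ∣ 3 := by exact_mod_cast h3
      exact h6 (h3'.trans (by norm_num))
    · exact hpu (hpi.dvd_of_dvd_pow h)

lemma aux_case_ne (m p : ℕ) (hn : (2 * m + 1).Prime) (hp : p.Prime) (hnp : 2 * m + 1 ≠ p)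
    (h6 : ¬ p ∣ 6) (u v : ℤ) (hcop : IsCoprime (12 * u ^ 2) (3 * u ^ 2 + 2 * v ^ 2))
    (hf : (p : ℤ) ∣ fpoly (2 * m + 1) u v) :
    2 * m + 1 ≤ if IsSquare (-6 : ZMod p) then p - 1 else p + 1 := by
  have hpi := Nat.prime_iff_prime_int.mp hp
  haveI : Fact p.Prime := ⟨hp⟩
  have h2 : ¬ p ∣ 2 := fun h => h6 (h.trans (by norm_num))
  have h3 : ¬ p ∣ 3 := fun h => h6 (h.trans (by norm_num))
  have hpv : ¬ (p : ℤ) ∣ v := by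
    intro hpv
    have hpu : ¬ (p : ℤ) ∣ u := by
      intro h
      exact hpi.not_isUnit (hcop.isUnit_of_dvd'
        (Dvd.dvd.mul_left (dvd_pow h (by norm_num)) _)
        (dvd_add (Dvd.dvd.mul_left (dvd_pow h (by norm_num)) _)
          (Dvd.dvd.mul_left (dvd_pow hpv (by norm_num)) _)))
    have h1 := (dvd_pow hpv two_ne_zero).trans (aux_mod_v m u v)
    rw [dvd_sub_right hf] at h1
    rcases hpi.dvd_or_dvd h1 with h | h
    · rcases hpi.dvd_or_dvd h with h | h
      · have h' : p ∣ 2 * m + 1 := by exact_mod_cast h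
        exact hnp ((Nat.prime_dvd_prime_iff_eq hp hn).mp h').symm
      · have := hpi.dvd_of_dvd_pow h
        exact h3 (by exact_mod_cast this)
    · exact hpu (hpi.dvd_of_dvd_pow h)
  let K := AlgebraicClosure (ZMod p)
  haveI : CharP K p := charP_of_injective_algebraMap (algebraMap (ZMod p) K).injective p
  have hp6 : ((6 : ℕ) : K) ≠ 0 := by rwa [Ne, CharP.cast_eq_zero_iff K p]
  have hp2 : ((2 : ℕ) : K) ≠ 0 := by rwa [Ne, CharP.cast_eq_zero_iff K p]
  have hvK : (v : K) ≠ 0 := by rwa [Ne, CharP.intCast_eq_zero_iff K p]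
  have hfK : (fpoly (2 * m + 1) u v : K) = 0 := by rwa [CharP.intCast_eq_zero_iff K p]
  push_cast at hp6 hp2
  obtain ⟨s, hs⟩ := IsAlgClosed.exists_pow_nat_eq (-6 : K) (n := 2) (by norm_num)
  have hs0 : s ≠ 0 := by
    rintro rfl
    apply hp6
    rw [← neg_eq_zero, ← hs]
    ring
  have hid := aux_identity s hs u v m
  rw [hfK, mul_zero, sub_eq_zero] at hid
  have hint : ∀ z : ℤ, (z : K) ^ p = z := by
    intro z
    have := ZMod.pow_card (z : ZMod p)
    have h := congrArg (algebraMap (ZMod p) K) this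
    rwa [map_pow, map_intCast] at h
  have hpodd : p = 2 * (p / 2) + 1 := by
    rcases hp.eq_two_or_odd with h | h
    · exact absurd (h ▸ dvd_rfl) h2
    · omega
  have hsp : s ^ p = s * (-6) ^ (p / 2) := by
    calc s ^ p = s ^ (2 * (p / 2) + 1) := congrArg (fun k => s ^ k) hpodd
      _ = _ := by rw [pow_succ, pow_mul, hs, mul_comm]
  have h60 : (-6 : ZMod p) ≠ 0 := by
    intro h
    rw [neg_eq_zero] at h
    exact h6 ((ZMod.natCast_eq_zero_iff 6 p).mp (by exact_mod_cast h))
  have hA : (3 * (u : K) + v * s) ^ p = 3 * u + v * s ^ p := by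
    rw [add_pow_char, mul_pow, mul_pow, hint, hint]
    have := hint 3
    push_cast at this
    rw [this]
  have hBB : (3 * (u : K) - v * s) ^ p = 3 * u - v * s ^ p := by
    rw [sub_pow_char, mul_pow, mul_pow, hint, hint]
    have := hint 3
    push_cast at this
    rw [this]
  have hab : (3 * (u : K) + v * s) ≠ 3 * (u : K) - v * s := by
    intro h
    have : 2 * (v * s) = 0 := by linear_combination h
    exact (mul_ne_zero hp2 (mul_ne_zero hvK hs0)) this
  generalize hadef : (3 * (u : K) + v * s) = a at *
  generalize hbdef : (3 * (u : K) - v * s) = b at *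
  have hb0 : b ≠ 0 := by
    intro h
    rw [h, zero_pow (by omega)] at hid
    exact hab (by rw [h]; exact pow_eq_zero_iff (by omega) |>.mp hid)
  have ha0 : a ≠ 0 := by
    intro h
    rw [h, zero_pow (by omega)] at hid
    exact hb0 (pow_eq_zero_iff (by omega) |>.mp hid.symm)
  haveI : Fact (2 * m + 1).Prime := ⟨hn⟩
  have hord : orderOf (a / b) = 2 * m + 1 := by
    apply orderOf_eq_prime
    · rw [div_pow, hid, div_self (pow_ne_zero _ hb0)]
    · rw [Ne, div_eq_one_iff_eq hb0]
      exact hab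
  have hle : ∀ k : ℕ, 0 < k → a ^ k = b ^ k → 2 * m + 1 ≤ k := by
    intro k hk h
    apply Nat.le_of_dvd hk
    rw [← hord]
    apply orderOf_dvd_of_pow_eq_one
    rw [div_pow, h, div_self (pow_ne_zero _ hb0)]
  have heul := ZMod.euler_criterion p h60
  split_ifs with hsq
  · have h1 := congrArg (algebraMap (ZMod p) K) (heul.mp hsq)
    simp only [map_pow, map_neg, map_ofNat, map_one] at h1
    rw [h1, mul_one] at hsp
    rw [hsp, hadef] at hA
    rw [hsp, hbdef] at hBB
    have hp1 := hp.two_le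
    apply hle (p - 1) (by omega)
    have hA' : a ^ (p - 1) = 1 := by
      apply mul_right_cancel₀ ha0
      rw [← pow_succ, Nat.sub_add_cancel (by omega), hA, one_mul]
    have hB' : b ^ (p - 1) = 1 := by
      apply mul_right_cancel₀ hb0
      rw [← pow_succ, Nat.sub_add_cancel (by omega), hBB, one_mul]
    rw [hA', hB']
  · have h0 := (ZMod.pow_div_two_eq_neg_one_or_one p h60).resolve_left
      (fun h => hsq (heul.mpr h))
    have h1 := congrArg (algebraMap (ZMod p) K) h0
    simp only [map_pow, map_neg, map_ofNat, map_one] at h1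
    rw [h1] at hsp
    have hA' : a ^ p = b := by rw [hA, hsp, ← hbdef]; ring
    have hB' : b ^ p = a := by rw [hBB, hsp, ← hadef]; ring
    apply hle (p + 1) (by omega)
    rw [pow_succ, pow_succ, hA', hB', mul_comm]

/-- Let `n` be an odd prime, `p` a prime with `p ∤ 6`, `b' ≥ 1`, and let
`u, v` be nonzero integers with `gcd(12u², 3u² + 2v²) = 1`, such that
`(3u + v√-6)ᵏ ≠ (3u - v√-6)ᵏ` for all `k ≥ 1` and `f_n(u,v) = p^b'`. With
`B = p - 1` if `-6` is a square mod `p` and `B = p + 1` otherwise, one has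
`n ≤ max(7, B)`. -/
theorem stmt15 (n p : ℕ) (hn : n.Prime) (hnodd : Odd n) (hp : p.Prime)
    (hp6 : ¬ p ∣ 6) (b' : ℕ) (hb' : 1 ≤ b') (u v : ℤ) (hu : u ≠ 0) (hv : v ≠ 0)
    (hcop : IsCoprime (12 * u ^ 2) (3 * u ^ 2 + 2 * v ^ 2))
    (hnru : ∀ k : ℕ, 1 ≤ k →
      (3 * (u : Zsqrtd (-6)) + (v : Zsqrtd (-6)) * Zsqrtd.sqrtd) ^ k ≠
        (3 * (u : Zsqrtd (-6)) - (v : Zsqrtd (-6)) * Zsqrtd.sqrtd) ^ k)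
    (hf : fpoly n u v = (p : ℤ) ^ b') (B : ℕ)
    (hB : B = if IsSquare (-6 : ZMod p) then p - 1 else p + 1) :
    n ≤ max 7 B := by
  obtain ⟨m, rfl⟩ := hnodd
  refine le_trans ?_ (le_max_right _ _)
  by_cases hnp : 2 * m + 1 = p
  · subst hnp
    exact (aux_case_eq m b' hn hp6 hb' u v hcop hf).elim
  · rw [hB]
    exact aux_case_ne m p hn hp hnp hp6 u v hcop (by rw [hf]; exact dvd_pow_self _ (by omega))
end
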